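/- Let α,β,γ > -1 be real and m,n ≥ 0 integers. Then for all integers i,j ≥ 0 with i + j < m + n, ∬_{T²} V_{m,n}^{α,β,γ}(x,y) · x^{i} y^{j} · W_{α,β,γ}(x,y) dx dy = 0; i.e. V_{m,n}^{α,β,γ} is orthogonal to every polynomial of total degree less than m+n with respect to the weight W_{α,β,γ} on T². -/

import Mathlib

open Real MeasureTheory

/-- The Pochhammer symbol `(a)_k = a(a+1)⋯(a+k-1) = Γ(a+k)/Γ(a)`. -/
noncomputable def poch (a : ℝ) (k : ℕ) : ℝ := ∏ i ∈ Finset.range k, (a + (i : ℝ))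

/-- Iterated partial derivative `∂^{k+l}/∂x^k ∂y^l` of a two-variable function. -/
noncomputable def pderiv2 (k l : ℕ) (f : ℝ → ℝ → ℝ) (x y : ℝ) : ℝ :=
  iteratedDeriv k (fun s => iteratedDeriv l (fun t => f s t) y) x

/-- Extended Beta function `B(x,y,z) = Γ(x)Γ(y)Γ(z)/Γ(x+y+z)`. -/
noncomputable def Beta3 (x y z : ℝ) : ℝ :=
  Real.Gamma x * Real.Gamma y * Real.Gamma z / Real.Gamma (x + y + z)

/-- The Appell polynomial `U_{k,n}^{α,β,γ}` given by the Rodrigues-type formula. -/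
noncomputable def Ukn (α β γ : ℝ) (k n : ℕ) (x y : ℝ) : ℝ :=
  (x ^ α * y ^ β * (1 - x - y) ^ γ)⁻¹ *
    pderiv2 k (n - k) (fun u v =>
      u ^ ((k : ℝ) + α) * v ^ ((n : ℝ) - (k : ℝ) + β) * (1 - u - v) ^ ((n : ℝ) + γ)) x y

/-- The normalized Jacobi weight on the triangle,
`W_{α,β,γ}(x,y) = x^α y^β (1-x-y)^γ / B(α+1,β+1,γ+1)`. -/
noncomputable def Wt (α β γ : ℝ) (x y : ℝ) : ℝ :=
  x ^ α * y ^ β * (1 - x - y) ^ γ / Beta3 (α + 1) (β + 1) (γ + 1)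

/-- The triangular region `T² = {(u,v) : 0 ≤ u, 0 ≤ v, u+v ≤ 1}`. -/
def T2 : Set (ℝ × ℝ) := {p | 0 ≤ p.1 ∧ 0 ≤ p.2 ∧ p.1 + p.2 ≤ 1}

/-- The biorthogonal (monic-basis) polynomial `V_{m,n}^{α,β,γ}`. -/
noncomputable def Vmn (α β γ : ℝ) (m n : ℕ) (x y : ℝ) : ℝ :=
  ∑ i ∈ Finset.range (m + 1), ∑ j ∈ Finset.range (n + 1),
    (-1 : ℝ) ^ (m + n + i + j) * (m.choose i : ℝ) * (n.choose j : ℝ) *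
      (poch (α + 1) m * poch (β + 1) n * poch (α + β + γ + 2) (m + n + i + j)) /
      (poch (α + 1) i * poch (β + 1) j * poch (α + β + γ + 2) (2 * m + 2 * n)) *
      x ^ i * y ^ j


open ProbabilityTheory in
lemma aux_beta (a b : ℝ) (ha : 0 < a) (hb : 0 < b) :
    ∫⁻ x in Set.Ioo (0:ℝ) 1, ENNReal.ofReal (x ^ (a - 1) * (1 - x) ^ (b - 1)) =
      ENNReal.ofReal (beta a b) := by
  have h := lintegral_betaPDF_eq_one ha hb
  rw [lintegral_betaPDF] at h
  have hB := beta_pos ha hb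
  have h2 : ∀ x : ℝ, ENNReal.ofReal (1 / beta a b * x ^ (a - 1) * (1 - x) ^ (b - 1)) =
      ENNReal.ofReal (1 / beta a b) * ENNReal.ofReal (x ^ (a - 1) * (1 - x) ^ (b - 1)) := by
    intro x
    rw [← ENNReal.ofReal_mul (by positivity), mul_assoc]
  simp_rw [h2] at h
  rw [lintegral_const_mul _ (by fun_prop)] at h
  set I := ∫⁻ x in Set.Ioo (0:ℝ) 1, ENNReal.ofReal (x ^ (a - 1) * (1 - x) ^ (b - 1))
  calc I = ENNReal.ofReal (beta a b) * (ENNReal.ofReal (1 / beta a b) * I) := by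
        rw [← mul_assoc, ← ENNReal.ofReal_mul hB.le, mul_one_div_cancel hB.ne']; simp
    _ = _ := by rw [h, mul_one]

open ProbabilityTheory in
lemma aux_beta_scaled (a b t : ℝ) (ha : 0 < a) (hb : 0 < b) (ht : 0 < t) :
    ∫⁻ x in Set.Ioo (0:ℝ) t, ENNReal.ofReal (x ^ (a - 1) * (t - x) ^ (b - 1)) =
      ENNReal.ofReal (t ^ (a + b - 1) * beta a b) := by
  have him : (fun x => t * x) '' Set.Ioo (0:ℝ) 1 = Set.Ioo 0 t := by
    rw [Set.image_mul_left_Ioo ht]; simp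
  rw [← him, lintegral_image_eq_lintegral_abs_deriv_mul (f' := fun _ => t) measurableSet_Ioo
    (fun x _ => by simpa using ((hasDerivAt_id x).const_mul t).hasDerivWithinAt)
    (fun x _ y _ h => mul_left_cancel₀ ht.ne' h)]
  rw [ENNReal.ofReal_mul (by positivity), ← aux_beta a b ha hb,
    ← lintegral_const_mul _ (by fun_prop)]
  refine setLIntegral_congr_fun measurableSet_Ioo fun x hx => ?_
  have hx0 := hx.1
  have hx1 : 0 < 1 - x := by linarith [hx.2]
  rw [← ENNReal.ofReal_mul (by positivity), ← ENNReal.ofReal_mul (by positivity)]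
  congr 1
  rw [abs_of_pos ht, show t - t * x = t * (1 - x) by ring, mul_rpow ht.le hx0.le,
    mul_rpow ht.le hx1.le, show a + b - 1 = 1 + (a - 1) + (b - 1) by ring, rpow_add ht,
    rpow_add ht, rpow_one]
  ring

/-- The open triangle. -/
def OT : Set (ℝ × ℝ) := {p | 0 < p.1 ∧ 0 < p.2 ∧ p.1 + p.2 < 1}

lemma OT_meas : MeasurableSet OT := by
  exact (measurableSet_lt measurable_const measurable_fst).inter
    ((measurableSet_lt measurable_const measurable_snd).inter
      (measurableSet_lt (measurable_fst.add measurable_snd) measurable_const))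

lemma T2_ae : T2 =ᵐ[volume] OT := by
  have h1 : ∀ᵐ p : ℝ × ℝ, p.1 ≠ 0 :=
    Measure.quasiMeasurePreserving_fst.ae (p := fun x : ℝ => x ≠ 0) (Measure.ae_ne volume 0)
  have h2 : ∀ᵐ p : ℝ × ℝ, p.2 ≠ 0 :=
    Measure.quasiMeasurePreserving_snd.ae (p := fun x : ℝ => x ≠ 0) (Measure.ae_ne volume 0)
  have h3 : ∀ᵐ p : ℝ × ℝ, p.1 + p.2 ≠ 1 := by
    rw [Measure.volume_eq_prod, Measure.ae_prod_iff_ae_ae]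
    · filter_upwards with x
      filter_upwards [Measure.ae_ne volume (1 - x)] with y hy h
      exact hy (by linarith)
    · exact (measurableSet_eq_fun (by fun_prop) (by fun_prop)).compl
  filter_upwards [h1, h2, h3] with p h1 h2 h3
  apply propext
  show (0 ≤ p.1 ∧ 0 ≤ p.2 ∧ p.1 + p.2 ≤ 1) ↔ (0 < p.1 ∧ 0 < p.2 ∧ p.1 + p.2 < 1)
  constructor
  · rintro ⟨a, b, c⟩
    exact ⟨lt_of_le_of_ne a h1.symm, lt_of_le_of_ne b h2.symm, lt_of_le_of_ne c h3⟩
  · rintro ⟨a, b, c⟩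
    exact ⟨a.le, b.le, c.le⟩

/-- The Dirichlet integrand. -/
noncomputable def dirI (a b c : ℝ) (p : ℝ × ℝ) : ℝ :=
  p.1 ^ (a - 1) * p.2 ^ (b - 1) * (1 - p.1 - p.2) ^ (c - 1)

lemma dirI_meas (a b c : ℝ) : Measurable (dirI a b c) := by
  unfold dirI; fun_prop

lemma dir_lintegral (a b c : ℝ) (ha : 0 < a) (hb : 0 < b) (hc : 0 < c) :
    ∫⁻ p in OT, ENNReal.ofReal (dirI a b c p) = ENNReal.ofReal (Beta3 a b c) := by
  rw [← lintegral_indicator OT_meas, Measure.volume_eq_prod, lintegral_prod]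
  swap
  · exact ((dirI_meas a b c).ennreal_ofReal.indicator OT_meas).aemeasurable
  have hin : ∀ x : ℝ, (∫⁻ y, OT.indicator (fun p => ENNReal.ofReal (dirI a b c p)) (x, y)) =
      (Set.Ioo (0:ℝ) 1).indicator (fun x => ENNReal.ofReal (x ^ (a - 1) * (1 - x) ^ (b + c - 1)) *
        ENNReal.ofReal (ProbabilityTheory.beta b c)) x := by
    intro x
    by_cases hx : x ∈ Set.Ioo (0:ℝ) 1
    · rw [Set.indicator_of_mem hx]
      have hx0 := hx.1
      have hx1 : 0 < 1 - x := by linarith [hx.2]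
      have hB := ProbabilityTheory.beta_pos hb hc
      rw [← ENNReal.ofReal_mul (by positivity), mul_assoc, ENNReal.ofReal_mul (by positivity),
        ← aux_beta_scaled b c (1 - x) hb hc hx1, ← lintegral_const_mul _ (by fun_prop),
        ← lintegral_indicator measurableSet_Ioo]
      refine lintegral_congr fun y => ?_
      by_cases hy : y ∈ Set.Ioo 0 (1 - x)
      · have hm : (x, y) ∈ OT := ⟨hx0, hy.1, by have := hy.2; simp only; linarith⟩
        rw [Set.indicator_of_mem hy, Set.indicator_of_mem hm,
          ← ENNReal.ofReal_mul (by positivity)]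
        simp only [dirI, mul_assoc]
      · have hm : (x, y) ∉ OT := fun h => hy ⟨h.2.1, by have := h.2.2; simp only at this; linarith⟩
        rw [Set.indicator_of_notMem hy, Set.indicator_of_notMem hm]
    · rw [Set.indicator_of_notMem hx]
      have : ∀ y, (x, y) ∉ OT := fun y h => hx ⟨h.1, by
        have h1 := h.2.1
        have h2 := h.2.2
        simp only at h1 h2; linarith⟩
      simp [Set.indicator_of_notMem (this _)]
  simp_rw [hin]
  rw [lintegral_indicator measurableSet_Ioo, lintegral_mul_const _ (by fun_prop),
    aux_beta a (b + c) ha (by positivity),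
    ← ENNReal.ofReal_mul (ProbabilityTheory.beta_pos ha (by positivity)).le]
  congr 1
  have := (Real.Gamma_pos_of_pos (add_pos hb hc)).ne'
  unfold ProbabilityTheory.beta Beta3
  rw [← add_assoc]
  field_simp

lemma dirI_nonneg (a b c : ℝ) : 0 ≤ᵐ[volume.restrict OT] dirI a b c := by
  refine ae_restrict_of_forall_mem OT_meas fun p hp => ?_
  have h1 := hp.1
  have h2 := hp.2.1
  have h3 : 0 < 1 - p.1 - p.2 := by linarith [hp.2.2]
  simp only [dirI, Pi.zero_apply]
  positivity

lemma Beta3_pos (a b c : ℝ) (ha : 0 < a) (hb : 0 < b) (hc : 0 < c) : 0 < Beta3 a b c := by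
  unfold Beta3
  have := Real.Gamma_pos_of_pos ha
  have := Real.Gamma_pos_of_pos hb
  have := Real.Gamma_pos_of_pos hc
  have := Real.Gamma_pos_of_pos (add_pos (add_pos ha hb) hc)
  positivity

lemma dir_integrable (a b c : ℝ) (ha : 0 < a) (hb : 0 < b) (hc : 0 < c) :
    IntegrableOn (dirI a b c) OT := by
  refine ⟨(dirI_meas a b c).aestronglyMeasurable, ?_⟩
  rw [hasFiniteIntegral_iff_ofReal (dirI_nonneg a b c), dir_lintegral a b c ha hb hc]
  exact ENNReal.ofReal_lt_top

lemma dir_integral (a b c : ℝ) (ha : 0 < a) (hb : 0 < b) (hc : 0 < c) :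
    ∫ p in OT, dirI a b c p = Beta3 a b c := by
  rw [integral_eq_lintegral_of_nonneg_ae (dirI_nonneg a b c)
    (dirI_meas a b c).aestronglyMeasurable, dir_lintegral a b c ha hb hc,
    ENNReal.toReal_ofReal (Beta3_pos a b c ha hb hc).le]

lemma alt_pow (m a : ℕ) (h : a < m) :
    ∑ k ∈ Finset.range (m + 1), (-1 : ℝ) ^ k * (m.choose k : ℝ) * (k : ℝ) ^ a = 0 := by
  have h1 := congrFun (fwdDiff_iter_pow_eq_zero_of_lt (R := ℝ) h) 0
  rw [fwdDiff_iter_eq_sum_shift] at h1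
  have h2 : ∑ k ∈ Finset.range (m + 1), (-1 : ℝ) ^ k * (m.choose k : ℝ) * (k : ℝ) ^ a =
    (-1) ^ m * ∑ k ∈ Finset.range (m + 1),
      ((-1 : ℤ) ^ (m - k) * m.choose k) • ((0:ℝ) + k • (1:ℝ)) ^ a := by
    rw [Finset.mul_sum]
    refine Finset.sum_congr rfl fun k hk => ?_
    have hk : k ≤ m := by simpa [Nat.lt_succ_iff] using hk
    obtain ⟨d, rfl⟩ := Nat.exists_eq_add_of_le hk
    have h3 : (-1 : ℝ) ^ d * (-1) ^ d = 1 := by rw [← mul_pow]; simp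
    simp only [add_tsub_cancel_left, zsmul_eq_mul, nsmul_eq_mul, pow_add]
    push_cast
    simp only [zero_add, mul_one]
    linear_combination -((-1:ℝ) ^ k * ((k + d).choose k : ℝ) * (k:ℝ) ^ a) * h3
  rw [h2, h1]; simp

open MvPolynomial in
lemma alt_mv (m n : ℕ) (P : MvPolynomial (Fin 2) ℝ) (h : P.totalDegree < m + n) :
    ∑ k ∈ Finset.range (m + 1), ∑ l ∈ Finset.range (n + 1),
      ((-1 : ℝ) ^ k * (m.choose k : ℝ)) * ((-1 : ℝ) ^ l * (n.choose l : ℝ)) *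
        eval ![(k : ℝ), (l : ℝ)] P = 0 := by
  have : ∀ k l : ℕ, ((-1 : ℝ) ^ k * (m.choose k : ℝ)) * ((-1 : ℝ) ^ l * (n.choose l : ℝ)) *
        eval ![(k : ℝ), (l : ℝ)] P = ∑ d ∈ P.support, P.coeff d *
          (((-1 : ℝ) ^ k * (m.choose k : ℝ) * (k:ℝ) ^ d 0) *
            ((-1 : ℝ) ^ l * (n.choose l : ℝ) * (l:ℝ) ^ d 1)) := by
    intro k l
    rw [eval_eq', Finset.mul_sum]
    refine Finset.sum_congr rfl fun d _ => ?_
    simp [Fin.prod_univ_two]; ring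
  simp_rw [this]
  simp_rw [Finset.sum_comm (t := P.support)]
  refine Finset.sum_eq_zero fun d hd => ?_
  simp_rw [← Finset.mul_sum]
  rw [← Finset.sum_mul]
  have hd' := le_totalDegree hd
  rw [Finsupp.sum_fintype _ _ (by simp), Fin.sum_univ_two] at hd'
  have : d 0 < m ∨ d 1 < n := by omega
  rcases this with h | h
  · rw [alt_pow m _ h]; simp
  · rw [alt_pow n _ h]; simp

lemma poch_add (a : ℝ) (k l : ℕ) : poch a (k + l) = poch a k * poch (a + k) l := by
  unfold poch
  rw [Finset.prod_range_add]
  congr 1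
  refine Finset.prod_congr rfl fun i _ => ?_
  push_cast; ring

lemma Gamma_poch (a : ℝ) (ha : 0 < a) (k : ℕ) :
    Real.Gamma (a + k) = poch a k * Real.Gamma a := by
  induction k with
  | zero => simp [poch]
  | succ k ih =>
    rw [poch_add, Nat.cast_succ, ← add_assoc, Real.Gamma_add_one (by positivity), ih]
    simp [poch]; ring

lemma poch_pos (a : ℝ) (ha : 0 < a) (k : ℕ) : 0 < poch a k :=
  Finset.prod_pos fun i _ => by positivity

open MvPolynomial in
lemma poch_poly (L : MvPolynomial (Fin 2) ℝ) (hL : L.totalDegree ≤ 1) (r : ℕ) :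
    ∃ P : MvPolynomial (Fin 2) ℝ, P.totalDegree ≤ r ∧
      ∀ v, eval v P = poch (eval v L) r := by
  refine ⟨∏ i ∈ Finset.range r, (L + C (i : ℝ)), ?_, ?_⟩
  · refine (totalDegree_finsetProd _ _).trans ?_
    refine (Finset.sum_le_sum (g := fun _ => 1) fun i _ => ?_).trans (by simp)
    refine (totalDegree_add _ _).trans ?_
    rw [totalDegree_C]
    simp [hL]
  · intro v
    simp [poch]

open MvPolynomial in
lemma alt_poch (m n i j : ℕ) (h : i + j < m + n) (a b s : ℝ) :
    ∑ k ∈ Finset.range (m + 1), ∑ l ∈ Finset.range (n + 1),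
      ((-1 : ℝ) ^ k * (m.choose k : ℝ)) * ((-1 : ℝ) ^ l * (n.choose l : ℝ)) *
        (poch (a + k) i * poch (b + l) j * poch (s + k + l) (m + n - (i + j + 1))) = 0 := by
  obtain ⟨P, hP, hP'⟩ := poch_poly (C a + X 0) ((totalDegree_add _ _).trans (by simp)) i
  obtain ⟨Q, hQ, hQ'⟩ := poch_poly (C b + X 1) ((totalDegree_add _ _).trans (by simp)) j
  obtain ⟨R, hR, hR'⟩ := poch_poly (C s + X 0 + X 1)
    ((totalDegree_add _ _).trans (by
      simpa using (totalDegree_add (C s) (X 0 : MvPolynomial (Fin 2) ℝ)).trans (by simp)))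
      (m + n - (i + j + 1))
  have hd : (P * Q * R).totalDegree < m + n := by
    have h1 := totalDegree_mul (P * Q) R
    have h2 := totalDegree_mul P Q
    omega
  have := alt_mv m n _ hd
  simpa [hP', hQ', hR'] using this

/-- The coefficients of `Vmn`. -/
noncomputable def cf (α β γ : ℝ) (m n k l : ℕ) : ℝ :=
  (-1 : ℝ) ^ (m + n + k + l) * (m.choose k : ℝ) * (n.choose l : ℝ) *
      (poch (α + 1) m * poch (β + 1) n * poch (α + β + γ + 2) (m + n + k + l)) /
      (poch (α + 1) k * poch (β + 1) l * poch (α + β + γ + 2) (2 * m + 2 * n))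

lemma integrand_eq (α β γ : ℝ) (m n i j : ℕ) (p : ℝ × ℝ) (hp : p ∈ OT) :
    Vmn α β γ m n p.1 p.2 * p.1 ^ i * p.2 ^ j * Wt α β γ p.1 p.2 =
      ∑ k ∈ Finset.range (m + 1), ∑ l ∈ Finset.range (n + 1),
        cf α β γ m n k l / Beta3 (α + 1) (β + 1) (γ + 1) *
          dirI (α + 1 + ((k + i : ℕ) : ℝ)) (β + 1 + ((l + j : ℕ) : ℝ)) (γ + 1) p := by
  have h1 := hp.1
  have h2 := hp.2.1
  simp only [Vmn, Finset.sum_mul]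
  refine Finset.sum_congr rfl fun k _ => Finset.sum_congr rfl fun l _ => ?_
  simp only [dirI, Wt]
  rw [show α + 1 + ((k + i : ℕ) : ℝ) - 1 = α + ((k + i : ℕ) : ℝ) by ring,
    show β + 1 + ((l + j : ℕ) : ℝ) - 1 = β + ((l + j : ℕ) : ℝ) by ring,
    show γ + 1 - 1 = γ by ring, rpow_add h1, rpow_add h2, rpow_natCast, rpow_natCast,
    pow_add p.1, pow_add p.2]
  change cf α β γ m n k l * _ * _ * _ * _ * _ = _
  ring

lemma alg_aux (s1 s2 s3 Ck Cl A D sv S T Z p q P Q g1 g2 g3 g4 B : ℝ)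
    (hp : p ≠ 0) (hq : q ≠ 0) (hS : S ≠ 0) :
    s1 * s2 * s3 * Ck * Cl * (A * D * (sv * S * T)) / (p * q * Z) / B *
      ((p * P * g1) * (q * Q * g2) * g3 / (S * g4)) =
    s1 * (A * D) / Z / B * (sv * g1 * g2 * g3 / g4) * (s2 * Ck * (s3 * Cl) * (P * Q * T)) := by
  have h1 : p * p⁻¹ = 1 := mul_inv_cancel₀ hp
  have h2 : q * q⁻¹ = 1 := mul_inv_cancel₀ hq
  have h3 : S * S⁻¹ = 1 := mul_inv_cancel₀ hS
  simp only [div_eq_mul_inv, mul_inv]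
  calc _ = (p * p⁻¹) * (q * q⁻¹) * (S * S⁻¹) * (s1 * (A * D) * Z⁻¹ * B⁻¹ *
        (sv * g1 * g2 * g3 * g4⁻¹) * (s2 * Ck * (s3 * Cl) * (P * Q * T))) := by ring
    _ = _ := by rw [h1, h2, h3]; ring

lemma poch_split (s : ℝ) (m n i j k l : ℕ) (hij : i + j < m + n) :
    poch s (m + n + k + l) = s * poch (s + 1) (k + l + i + j) *
      poch (s + ((i + j + 1 : ℕ) : ℝ) + k + l) (m + n - (i + j + 1)) := by
  rw [show m + n + k + l = (1 + (k + l + i + j)) + (m + n - (i + j + 1)) by omega,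
    poch_add, poch_add]
  congr 2
  · simp [poch]
  · simp
  · push_cast; ring

lemma term_eq (α β γ : ℝ) (hα : -1 < α) (hβ : -1 < β) (hγ : -1 < γ)
    (m n i j k l : ℕ) (hij : i + j < m + n) :
    cf α β γ m n k l / Beta3 (α + 1) (β + 1) (γ + 1) *
      Beta3 (α + 1 + ((k + i : ℕ) : ℝ)) (β + 1 + ((l + j : ℕ) : ℝ)) (γ + 1) =
    (-1 : ℝ) ^ (m + n) * (poch (α + 1) m * poch (β + 1) n) /
        poch (α + β + γ + 2) (2 * m + 2 * n) / Beta3 (α + 1) (β + 1) (γ + 1) *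
      ((α + β + γ + 2) * Real.Gamma (α + 1) * Real.Gamma (β + 1) * Real.Gamma (γ + 1) /
        Real.Gamma (α + β + γ + 2 + 1)) *
    (((-1 : ℝ) ^ k * (m.choose k : ℝ)) * ((-1 : ℝ) ^ l * (n.choose l : ℝ)) *
        (poch (α + 1 + k) i * poch (β + 1 + l) j *
          poch (α + β + γ + 2 + ((i + j + 1 : ℕ) : ℝ) + k + l) (m + n - (i + j + 1)))) := by
  have ha : 0 < α + 1 := by linarith
  have hb : 0 < β + 1 := by linarith
  have hs1 : 0 < α + β + γ + 2 + 1 := by linarith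
  generalize Beta3 (α + 1) (β + 1) (γ + 1) = B
  unfold cf Beta3
  rw [show α + 1 + ((k + i : ℕ) : ℝ) + (β + 1 + ((l + j : ℕ) : ℝ)) + (γ + 1)
    = α + β + γ + 2 + 1 + ((k + l + i + j : ℕ) : ℝ) by push_cast; ring]
  rw [Gamma_poch _ ha, Gamma_poch _ hb, Gamma_poch _ hs1, poch_add _ k i, poch_add _ l j,
    poch_split _ m n i j k l hij, pow_add _ _ l, pow_add _ _ k]
  exact alg_aux _ _ _ _ _ _ _ _ _ _ _ _ _ _ _ _ _ _ _ _ (poch_pos _ ha k).ne'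
    (poch_pos _ hb l).ne' (poch_pos _ hs1 _).ne'

/-- `V_{m,n}^{α,β,γ}` is orthogonal to all monomials (hence all polynomials)
of total degree less than `m+n` with respect to the Jacobi weight on the
triangle. -/
theorem stmt7 (α β γ : ℝ) (hα : -1 < α) (hβ : -1 < β) (hγ : -1 < γ)
    (m n : ℕ) : ∀ i j : ℕ, i + j < m + n →
    ∫ p in T2, Vmn α β γ m n p.1 p.2 * p.1 ^ i * p.2 ^ j * Wt α β γ p.1 p.2 = 0 := by
  intro i j hij
  rw [setIntegral_congr_set T2_ae]
  have ha : 0 < α + 1 := by linarith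
  have hb : 0 < β + 1 := by linarith
  have hc : 0 < γ + 1 := by linarith
  rw [setIntegral_congr_fun OT_meas (fun p hp => integrand_eq α β γ m n i j p hp)]
  have hint : ∀ k l : ℕ, Integrable (fun p => cf α β γ m n k l / Beta3 (α + 1) (β + 1) (γ + 1) *
      dirI (α + 1 + ((k + i : ℕ) : ℝ)) (β + 1 + ((l + j : ℕ) : ℝ)) (γ + 1) p)
      (volume.restrict OT) := fun k l =>
    (dir_integrable _ _ _ (by positivity) (by positivity) hc).const_mul _
  rw [integral_finsetSum _ fun k _ => integrable_finsetSum _ fun l _ => hint k l]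
  have halt := alt_poch m n i j hij (α + 1) (β + 1) (α + β + γ + 2 + ((i + j + 1 : ℕ) : ℝ))
  have hz := congrArg (fun t => ((-1 : ℝ) ^ (m + n) * (poch (α + 1) m * poch (β + 1) n) /
        poch (α + β + γ + 2) (2 * m + 2 * n) / Beta3 (α + 1) (β + 1) (γ + 1) *
      ((α + β + γ + 2) * Real.Gamma (α + 1) * Real.Gamma (β + 1) * Real.Gamma (γ + 1) /
        Real.Gamma (α + β + γ + 2 + 1))) * t) halt
  simp only [mul_zero] at hz
  rw [← hz, Finset.mul_sum]
  refine Finset.sum_congr rfl fun k _ => ?_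
  rw [integral_finsetSum _ fun l _ => hint k l, Finset.mul_sum]
  refine Finset.sum_congr rfl fun l _ => ?_
  rw [integral_const_mul, dir_integral _ _ _ (by positivity) (by positivity) hc]
  exact term_eq α β γ hα hβ hγ m n i j k l hij
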